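/- arXiv:2511.15662 — 2 statements merged into one kernel-verified Lean document; each statement's English description precedes it below -/
import Mathlib

section
/- There exist constants C > 0 and ξ ∈ (0,1) such that for every C¹ function φ : ℝ/ℤ → ℝ, every continuous function ψ : ℝ/ℤ → ℝ, and every integer n ≥ 1, |∫ φ·(ψ∘fⁿ) dμ − (∫ φ dμ)(∫ ψ dμ)| ≤ C·ξⁿ·‖φ‖_{C¹}·‖ψ‖_{C⁰} (exponential decay of correlations for the measure of maximal entropy). -/
open MeasureTheory Filter

noncomputable section

/-- The transfer operator `ℒφ(x) = ∑_{f y = x} φ y`. -/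
def transfer (f : AddCircle (1:ℝ) → AddCircle (1:ℝ)) (φ : AddCircle (1:ℝ) → ℝ) : AddCircle (1:ℝ) → ℝ :=
  fun x => ∑ᶠ y ∈ f ⁻¹' {x}, φ y


lemma aux_inv (K : ℕ) (F : ℝ → ℝ) (hF : ContDiff ℝ 2 F)
    (lam : ℝ) (hlam : 1 < lam) (hexp : ∀ x : ℝ, lam ≤ deriv F x) :
    ∃ G : ℝ → ℝ, (∀ x, F (G x) = x) ∧ (∀ x, G (F x) = x) ∧
      ∀ x y, |G x - G y| ≤ lam⁻¹ * |x - y| := by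
  have hd : Differentiable ℝ F := hF.differentiable (by norm_num)
  have hm : Monotone (fun x => F x - lam * x) := by
    apply monotone_of_deriv_nonneg
    · fun_prop
    · intro x
      have h : HasDerivAt (fun x => F x - lam * x) (deriv F x - lam * 1) x :=
        (hd x).hasDerivAt.sub ((hasDerivAt_id x).const_mul lam)
      rw [h.deriv]; linarith [hexp x]
  have hlow : ∀ x y, lam * |x - y| ≤ |F x - F y| := by
    intro x y
    rcases le_total x y with h | h
    · have := hm h
      simp only at this
      rw [abs_sub_comm x, abs_sub_comm (F x), abs_of_nonneg (by linarith : 0 ≤ y - x)]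
      exact le_trans (by linarith) (le_abs_self _)
    · have := hm h
      simp only at this
      rw [abs_of_nonneg (by linarith : 0 ≤ x - y)]
      exact le_trans (by linarith) (le_abs_self _)
  have hsurj : Function.Surjective F := by
    apply hd.continuous.surjective
    · apply tendsto_atTop_mono' atTop (f₁ := fun x => F 0 + lam * x)
      · filter_upwards [eventually_ge_atTop 0] with x hx
        have := hm hx
        simp only at this
        linarith
      · exact tendsto_atTop_add_const_left _ _ (tendsto_id.const_mul_atTop (by linarith))
    · refine tendsto_atBot_mono' (f₁ := fun x => F 0 + lam * x) atBot ?_ ?_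
      · filter_upwards [eventually_le_atBot 0] with x hx
        have := hm hx
        simp only at this
        linarith
      · exact tendsto_atBot_add_const_left _ _ (tendsto_id.const_mul_atBot (by linarith))
  choose G hG using hsurj
  refine ⟨G, hG, ?_, ?_⟩
  · intro x
    have := hlow (G (F x)) x
    rw [hG, sub_self, abs_zero] at this
    have h2 : |G (F x) - x| ≤ 0 := by
      by_contra hc
      push Not at hc
      nlinarith
    exact sub_eq_zero.mp (abs_nonpos_iff.mp h2)
  · intro x y
    have := hlow (G x) (G y)
    rw [hG, hG] at this
    rw [inv_mul_eq_div, le_div_iff₀ (by linarith)]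
    linarith

lemma aux_cont {X : Type*} [TopologicalSpace X] (g : AddCircle (1:ℝ) → X)
    (h : Continuous fun x : ℝ => g (x : AddCircle (1:ℝ))) : Continuous g :=
  (QuotientAddGroup.isQuotientMap_mk (N := AddSubgroup.zmultiples (1:ℝ))).continuous_iff.mpr h

lemma aux_coe (x y : ℝ) : (x : AddCircle (1:ℝ)) = y ↔ ∃ n : ℤ, x = y + n := by
  constructor
  · intro h
    have h' : ((x - y : ℝ) : AddCircle (1:ℝ)) = 0 := by
      rw [AddCircle.coe_sub, h, sub_self]
    obtain ⟨n, hn⟩ := (AddCircle.coe_eq_zero_iff (1:ℝ)).mp h'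
    refine ⟨n, ?_⟩
    simp at hn
    linarith
  · rintro ⟨n, rfl⟩
    have : ((n : ℝ) : AddCircle (1:ℝ)) = 0 :=
      (AddCircle.coe_eq_zero_iff (1:ℝ)).mpr ⟨n, by simp⟩
    rw [AddCircle.coe_add, this, add_zero]

lemma aux_transfer (K : ℕ) (hK : 2 ≤ K) (F G : ℝ → ℝ)
    (hdeg : ∀ x : ℝ, F (x + 1) = F x + K) (hFG : ∀ x, F (G x) = x) (hGF : ∀ x, G (F x) = x)
    (f : AddCircle (1:ℝ) → AddCircle (1:ℝ))
    (hfF : ∀ x : ℝ, f (x : AddCircle (1:ℝ)) = ((F x : ℝ) : AddCircle (1:ℝ)))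
    (φ : AddCircle (1:ℝ) → ℝ) (x : ℝ) :
    transfer f φ (x : AddCircle (1:ℝ)) =
      ∑ j ∈ Finset.range K, φ ((G (x + j) : ℝ) : AddCircle (1:ℝ)) := by
  have hKpos : (0:ℤ) < K := by omega
  have hZ : ∀ (n : ℤ) (t : ℝ), F (t + n) = F t + n * K := by
    intro n
    induction n using Int.induction_on with
    | zero => simp
    | succ n ih =>
      intro t
      have := hdeg (t + n)
      have h2 := ih t
      push_cast at *
      rw [← add_assoc, this, h2]; ring
    | pred n ih =>
      intro t
      have := hdeg (t + ((-(n:ℤ) - 1 : ℤ) : ℝ))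
      have h2 := ih t
      push_cast at *
      rw [show t + (-(n:ℝ) - 1) + 1 = t + -n by ring, h2] at this
      linarith
  have hset : f ⁻¹' {(x : AddCircle (1:ℝ))} =
      (fun j : ℕ => ((G (x + j) : ℝ) : AddCircle (1:ℝ))) '' (Finset.range K : Set ℕ) := by
    ext y
    constructor
    · intro hy
      obtain ⟨t, rfl⟩ := QuotientAddGroup.mk_surjective y
      have hy' : ((F t : ℝ) : AddCircle (1:ℝ)) = x := by rw [← hfF]; exact hy
      obtain ⟨m, hm⟩ := (aux_coe _ _).mp hy'
      have h0 := Int.emod_nonneg m hKpos.ne'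
      have h1 := Int.emod_lt_of_pos m hKpos
      refine ⟨(m % K).toNat, ?_, ?_⟩
      · simp only [Finset.coe_range, Set.mem_Iio]; omega
      · refine (aux_coe _ _).mpr ⟨-(m / K), ?_⟩
        have hc : (((m % K).toNat : ℕ) : ℝ) = ((m % K : ℤ) : ℝ) := by
          have := Int.toNat_of_nonneg h0
          exact_mod_cast this
        have hd : (m : ℝ) = ((m % K : ℤ) : ℝ) + K * ((m / K : ℤ) : ℝ) := by
          have := Int.emod_add_mul_ediv m K
          exact_mod_cast this.symm
        rw [← hGF (t + _), hZ, hm, hc, hd]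
        congr 1
        push_cast
        ring
    · rintro ⟨j, -, rfl⟩
      change f _ = _
      rw [hfF, hFG]
      exact (aux_coe _ _).mpr ⟨j, by simp⟩
  have hinj : Set.InjOn (fun j : ℕ => ((G (x + j) : ℝ) : AddCircle (1:ℝ)))
      (Finset.range K : Set ℕ) := by
    intro i hi j hj hij
    simp only [Finset.coe_range, Set.mem_Iio] at hi hj
    obtain ⟨n, hn⟩ := (aux_coe _ _).mp hij
    have := congrArg F hn
    rw [hZ, hFG, hFG] at this
    have h2 : (i : ℤ) = j + n * K := by
      have : (i : ℝ) = j + n * K := by linarith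
      exact_mod_cast this
    have h3 : n = 0 := by
      by_contra h
      rcases lt_or_gt_of_ne h with h | h
      · nlinarith
      · nlinarith
    subst h3
    omega
  unfold transfer
  rw [hset, finsum_mem_image hinj, finsum_mem_coe_finset]

lemma aux_main
    (K : ℕ) (hK : 2 ≤ K) (F G : ℝ → ℝ) (hFc : Continuous F)
    (hdeg : ∀ x : ℝ, F (x + 1) = F x + K) (hFG : ∀ x, F (G x) = x) (hGF : ∀ x, G (F x) = x)
    (lam : ℝ) (hlam : 1 < lam) (hG : ∀ x y, |G x - G y| ≤ lam⁻¹ * |x - y|)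
    (f : AddCircle (1:ℝ) → AddCircle (1:ℝ))
    (hfF : ∀ x : ℝ, f (x : AddCircle (1:ℝ)) = ((F x : ℝ) : AddCircle (1:ℝ)))
    (μ : Measure (AddCircle (1:ℝ))) [IsProbabilityMeasure μ]
    (hμ : ∀ φ : AddCircle (1:ℝ) → ℝ, Continuous φ →
      ∫ x, transfer f φ x ∂μ = (K : ℝ) * ∫ x, φ x ∂μ)
    (ψ : AddCircle (1:ℝ) → ℝ) (hψ : Continuous ψ) (n : ℕ) :
    ∀ (φ : AddCircle (1:ℝ) → ℝ) (M : ℝ), 0 ≤ M →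
      (∀ x y : ℝ, |φ (x : AddCircle (1:ℝ)) - φ (y : AddCircle (1:ℝ))| ≤ M * |x - y|) →
      |(∫ x, φ x * ψ (f^[n] x) ∂μ) - (∫ x, φ x ∂μ) * ∫ x, ψ x ∂μ| ≤
        M * lam⁻¹ ^ n * ⨆ p : AddCircle (1:ℝ), |ψ p| := by
  have hK0 : (K : ℝ) ≠ 0 := by
    have : K ≠ 0 := by omega
    exact_mod_cast this
  have hfc : Continuous f := by
    apply aux_cont
    simp only [hfF]
    exact (AddCircle.continuous_mk' 1).comp hFc
  have hcont : ∀ (φ : AddCircle (1:ℝ) → ℝ) (M : ℝ), 0 ≤ M →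
      (∀ x y : ℝ, |φ (x : AddCircle (1:ℝ)) - φ (y : AddCircle (1:ℝ))| ≤ M * |x - y|) →
      Continuous φ := by
    intro φ M hM h
    apply aux_cont
    apply LipschitzWith.continuous (K := ⟨M, hM⟩)
    exact LipschitzWith.of_dist_le_mul fun x y => h x y
  have hint : ∀ g : AddCircle (1:ℝ) → ℝ, Continuous g → Integrable g μ := fun g hg =>
    hg.integrable_of_hasCompactSupport (HasCompactSupport.of_compactSpace g)
  induction n with
  | zero =>
    intro φ M hM hφ
    have hc := hcont φ M hM hφ
    have hosc : ∀ p q, |φ p - φ q| ≤ M := by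
      intro p q
      obtain ⟨a, ha, rfl⟩ : ∃ a ∈ Set.Ico (0:ℝ) (0+1), (a : AddCircle (1:ℝ)) = p := by
        have := AddCircle.coe_image_Ico_eq (1:ℝ) 0
        have h : p ∈ (Set.univ : Set (AddCircle (1:ℝ))) := trivial
        rw [← this] at h; exact h
      obtain ⟨b, hb, rfl⟩ : ∃ a ∈ Set.Ico (0:ℝ) (0+1), (a : AddCircle (1:ℝ)) = q := by
        have := AddCircle.coe_image_Ico_eq (1:ℝ) 0
        have h : q ∈ (Set.univ : Set (AddCircle (1:ℝ))) := trivial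
        rw [← this] at h; exact h
      have h1 : |a - b| ≤ 1 := by
        rw [abs_le]; constructor <;> linarith [ha.1, ha.2, hb.1, hb.2]
      exact (hφ a b).trans (mul_le_of_le_one_right hM h1)
    have hmean : ∀ p, |φ p - ∫ x, φ x ∂μ| ≤ M := by
      intro p
      have : φ p - ∫ x, φ x ∂μ = ∫ x, (φ p - φ x) ∂μ := by
        rw [integral_sub (integrable_const _) (hint φ hc)]; simp
      rw [this]
      have := norm_integral_le_of_norm_le_const (μ := μ) (f := fun x => φ p - φ x) (C := M)
        (Eventually.of_forall fun x => hosc p x)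
      simpa using this
    have hb : BddAbove (Set.range fun p => |ψ p|) := by
      have := isCompact_range (hψ.abs)
      exact this.bddAbove
    have heq : (∫ x, φ x * ψ (f^[0] x) ∂μ) - (∫ x, φ x ∂μ) * ∫ x, ψ x ∂μ
        = ∫ x, (φ x - ∫ y, φ y ∂μ) * ψ x ∂μ := by
      simp only [sub_mul]
      rw [integral_sub (hint (fun x => φ x * ψ x) (hc.mul hψ)) ((hint _ hψ).const_mul _), integral_const_mul]
      simp
    rw [heq]
    have := norm_integral_le_of_norm_le_const (μ := μ)
      (f := fun x => (φ x - ∫ y, φ y ∂μ) * ψ x) (C := M * ⨆ p, |ψ p|)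
      (Eventually.of_forall fun x => by
        rw [norm_mul]
        exact mul_le_mul (hmean x) (le_ciSup hb x) (norm_nonneg _) hM)
    simpa using this
  | succ n ih =>
    intro φ M hM hφ
    have hc := hcont φ M hM hφ
    have htr := aux_transfer K hK F G hdeg hFG hGF f hfF
    have hL : ∀ x y : ℝ, |(K:ℝ)⁻¹ * transfer f φ (x : AddCircle (1:ℝ)) -
        (K:ℝ)⁻¹ * transfer f φ (y : AddCircle (1:ℝ))| ≤ (M * lam⁻¹) * |x - y| := by
      intro x y
      rw [← mul_sub, htr, htr, ← Finset.sum_sub_distrib, abs_mul, abs_of_nonneg (by positivity),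
        inv_mul_le_iff₀ (by positivity)]
      refine (Finset.abs_sum_le_sum_abs _ _).trans ?_
      refine (Finset.sum_le_card_nsmul _ _ (M * lam⁻¹ * |x - y|) ?_).trans ?_
      · intro j _
        refine (hφ _ _).trans ?_
        have := hG (x + j) (y + j)
        rw [add_sub_add_right_eq_sub] at this
        rw [mul_assoc]
        exact mul_le_mul_of_nonneg_left this hM
      · simp
    have key := ih (fun p => (K:ℝ)⁻¹ * transfer f φ p) (M * lam⁻¹) (by positivity) hL
    have e1 : ∫ p, (K:ℝ)⁻¹ * transfer f φ p ∂μ = ∫ p, φ p ∂μ := by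
      rw [integral_const_mul, hμ φ hc, inv_mul_cancel_left₀ hK0]
    have e2 : ∫ p, (K:ℝ)⁻¹ * transfer f φ p * ψ (f^[n] p) ∂μ
        = ∫ p, φ p * ψ (f^[n+1] p) ∂μ := by
      have hc2 : Continuous fun p => φ p * ψ (f^[n+1] p) :=
        hc.mul (hψ.comp (hfc.iterate _))
      have h := hμ _ hc2
      have : ∀ p, transfer f (fun p => φ p * ψ (f^[n+1] p)) p
          = transfer f φ p * ψ (f^[n] p) := by
        intro p
        obtain ⟨x, rfl⟩ := QuotientAddGroup.mk_surjective p
        change transfer f _ (x : AddCircle (1:ℝ)) = transfer f φ (x : AddCircle (1:ℝ)) *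
          ψ (f^[n] (x : AddCircle (1:ℝ)))
        rw [htr, htr, Finset.sum_mul]
        refine Finset.sum_congr rfl fun j _ => ?_
        rw [Function.iterate_succ_apply, hfF, hFG, (aux_coe (x + j) x).mpr ⟨j, by simp⟩]
      simp only [this] at h
      simp only [mul_assoc]
      rw [integral_const_mul, h, inv_mul_cancel_left₀ hK0]
    rw [e1, e2] at key
    rw [pow_succ' lam⁻¹ n, ← mul_assoc]
    exact key

/-- Exponential decay of correlations for the measure of maximal entropy. -/
theorem stmt6
    (K : ℕ) (hK : 2 ≤ K)
    (F : ℝ → ℝ) (hF : ContDiff ℝ 2 F)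
    (hdeg : ∀ x : ℝ, F (x + 1) = F x + K)
    (lam : ℝ) (hlam : 1 < lam)
    (hexp : ∀ x : ℝ, lam ≤ deriv F x)
    (f : AddCircle (1:ℝ) → AddCircle (1:ℝ))
    (hfF : ∀ x : ℝ, f (x : AddCircle (1:ℝ)) = ((F x : ℝ) : AddCircle (1:ℝ)))
    (μ : Measure (AddCircle (1:ℝ))) [IsProbabilityMeasure μ]
    (hinv : ∀ φ : AddCircle (1:ℝ) → ℝ, Continuous φ → ∫ x, φ (f x) ∂μ = ∫ x, φ x ∂μ)
    (hμ : ∀ φ : AddCircle (1:ℝ) → ℝ, Continuous φ → ∫ x, transfer f φ x ∂μ = (K : ℝ) * ∫ x, φ x ∂μ)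
    :
    ∃ C ξ : ℝ, 0 < C ∧ 0 < ξ ∧ ξ < 1 ∧
      ∀ (φ : AddCircle (1:ℝ) → ℝ) (Φ : ℝ → ℝ), ContDiff ℝ 1 Φ →
        (∀ x : ℝ, φ (x : AddCircle (1:ℝ)) = Φ x) →
        ∀ ψ : AddCircle (1:ℝ) → ℝ, Continuous ψ → ∀ n : ℕ, 1 ≤ n →
          |(∫ x, φ x * ψ (f^[n] x) ∂μ) - (∫ x, φ x ∂μ) * ∫ x, ψ x ∂μ| ≤
            C * ξ ^ n * ((⨆ x : ℝ, |Φ x|) + ⨆ x : ℝ, |deriv Φ x|) *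
              ⨆ p : AddCircle (1:ℝ), |ψ p| := by
  obtain ⟨G, hFG, hGF, hG⟩ := aux_inv K F hF lam hlam hexp
  refine ⟨1, lam⁻¹, one_pos, by positivity, inv_lt_one_of_one_lt₀ hlam, ?_⟩
  intro φ Φ hΦ hφ ψ hψ n _
  have hper : Function.Periodic (deriv Φ) 1 := by
    intro x
    have hp : (fun y => Φ (y + 1)) = Φ := by
      funext y
      rw [← hφ, ← hφ]
      simp
    rw [← deriv_comp_add_const, hp]
  have hdc : Continuous (deriv Φ) := hΦ.continuous_deriv le_rfl
  have hb : BddAbove (Set.range fun x => |deriv Φ x|) := by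
    have hp2 : Function.Periodic (fun x => |deriv Φ x|) 1 := fun x => by simp only [hper x]
    exact (hp2.compact_of_continuous one_ne_zero hdc.abs).bddAbove
  have hM : 0 ≤ ⨆ x, |deriv Φ x| := Real.iSup_nonneg fun x => abs_nonneg _
  have hM0 : 0 ≤ ⨆ x, |Φ x| := Real.iSup_nonneg fun x => abs_nonneg _
  have hψ0 : 0 ≤ ⨆ p, |ψ p| := Real.iSup_nonneg fun x => abs_nonneg _
  have hLip : ∀ x y : ℝ, |φ (x : AddCircle (1:ℝ)) - φ (y : AddCircle (1:ℝ))| ≤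
      (⨆ x, |deriv Φ x|) * |x - y| := by
    intro x y
    rw [hφ, hφ]
    exact Convex.norm_image_sub_le_of_norm_deriv_le (s := Set.univ) (f := Φ)
      (fun z _ => (hΦ.differentiable one_ne_zero) z) (fun z _ => le_ciSup hb z) convex_univ
      trivial trivial
  refine (aux_main K hK F G hF.continuous hdeg hFG hGF lam hlam hG f hfF μ hμ ψ hψ n φ _ hM
    hLip).trans ?_
  have hl : 0 ≤ lam⁻¹ ^ n := by positivity
  refine mul_le_mul_of_nonneg_right ?_ hψ0
  rw [one_mul, mul_comm]
  exact mul_le_mul_of_nonneg_left (by linarith) hl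
end
end

section
/- For every point z ∈ ℝ/ℤ and all integers n ≥ 1 and 1 ≤ j ≤ n − 1, |ℒⁿ(ĥ·(ĥ∘f^j))(z) − ∑_{p ∈ Fix(fⁿ)} ĥ(p)·ĥ(f^j(p))| ≤ ‖ĥ‖²_{C⁰} + ‖ĥ‖_{C⁰}·‖ĥ'‖_{C⁰}·(1 + K^j). -/
open MeasureTheory Filter

noncomputable section

/-- The set of periodic points of period `n` (not necessarily least period). -/
def FixPts (f : AddCircle (1:ℝ) → AddCircle (1:ℝ)) (n : ℕ) : Set (AddCircle (1:ℝ)) :=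
  {p | f^[n] p = p}

lemma aux_ivt (H : ℝ → ℝ) (hc : Continuous H) (M : ℕ) (hd : ∀ x, H (x + 1) = H x + M) (z v : ℝ)
    (h1 : H z ≤ v) (h2 : v < H z + M) : ∃ x, z ≤ x ∧ x < z + 1 ∧ H x = v := by
  have h := intermediate_value_Icc (show z ≤ z + 1 by linarith) hc.continuousOn
  have hv : v ∈ Set.Icc (H z) (H (z + 1)) := ⟨h1, by rw [hd]; exact h2.le⟩
  obtain ⟨x, ⟨hx1, hx2⟩, hx⟩ := h hv
  refine ⟨x, hx1, lt_of_le_of_ne hx2 ?_, hx⟩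
  rintro rfl
  rw [hd] at hx
  linarith

lemma aux_coe_eq (x y : ℝ) : ((x : AddCircle (1:ℝ)) = (y : AddCircle (1:ℝ))) ↔ ∃ m : ℤ, x = y + m := by
  rw [QuotientAddGroup.eq_iff_sub_mem, AddSubgroup.mem_zmultiples_iff]
  constructor
  · rintro ⟨k, hk⟩
    refine ⟨k, ?_⟩
    simp at hk
    linarith
  · rintro ⟨k, hk⟩
    refine ⟨k, ?_⟩
    simp
    linarith

lemma aux_inj (z x y : ℝ) (hx : z ≤ x) (hx' : x < z + 1) (hy : z ≤ y) (hy' : y < z + 1)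
    (h : (x : AddCircle (1:ℝ)) = (y : AddCircle (1:ℝ))) : x = y := by
  obtain ⟨m, hm⟩ := (aux_coe_eq x y).1 h
  have h1 : (m : ℝ) < 1 := by linarith
  have h2 : (-1 : ℝ) < m := by linarith
  have h3 : m < 1 := by exact_mod_cast h1
  have h4 : -1 < m := by exact_mod_cast h2
  have : m = 0 := by omega
  subst this
  simpa using hm

lemma aux_rep (z : ℝ) (p : AddCircle (1:ℝ)) : ∃ x : ℝ, z ≤ x ∧ x < z + 1 ∧ (x : AddCircle (1:ℝ)) = p := by
  obtain ⟨w, rfl⟩ := QuotientAddGroup.mk_surjective p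
  refine ⟨w - ⌊w - z⌋, ?_, ?_, ?_⟩
  · linarith [Int.floor_le (w - z)]
  · linarith [Int.lt_floor_add_one (w - z)]
  · refine (aux_coe_eq _ _).2 ⟨-⌊w - z⌋, ?_⟩
    push_cast
    ring

lemma aux_param (A : Set (AddCircle (1:ℝ))) (H : ℝ → ℝ) (hm : StrictMono H) (hc : Continuous H) (M : ℕ)
    (hd : ∀ x, H (x + 1) = H x + M) (z c : ℝ)
    (a : ℤ) (ha1 : H z - c ≤ a) (ha2 : (a : ℝ) < H z - c + 1)
    (hA : ∀ x : ℝ, (x : AddCircle (1:ℝ)) ∈ A ↔ ∃ m : ℤ, H x = c + m) :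
    ∃ y : ℕ → ℝ, (∀ i < M, z ≤ y i ∧ y i < z + 1 ∧ H (y i) = c + a + i) ∧
      A.Finite ∧
      ∀ φ : AddCircle (1:ℝ) → ℝ, ∑ᶠ p ∈ A, φ p = ∑ i ∈ Finset.range M, φ (y i) := by
  have key : ∀ i : ℕ, ∃ x : ℝ, i < M → z ≤ x ∧ x < z + 1 ∧ H x = c + a + i := by
    intro i
    by_cases hi : i < M
    · have hi' : (i : ℝ) + 1 ≤ M := by exact_mod_cast hi
      have h0 : (0 : ℝ) ≤ i := Nat.cast_nonneg i
      obtain ⟨x, hx⟩ := aux_ivt H hc M hd z (c + a + i) (by linarith) (by linarith)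
      exact ⟨x, fun _ => hx⟩
    · exact ⟨0, fun h => absurd h hi⟩
  choose y hy using key
  have himg : A = Set.image (fun i : ℕ => (y i : AddCircle (1:ℝ))) (Finset.range M : Set ℕ) := by
    ext p
    constructor
    · intro hp
      obtain ⟨x, hx1, hx2, rfl⟩ := aux_rep z p
      obtain ⟨m, hm'⟩ := (hA x).1 hp
      have e1 : H z ≤ H x := hm.monotone hx1
      have e2 : H x < H z + M := by rw [← hd]; exact hm hx2
      have e3 : (a : ℝ) < m + 1 := by linarith
      have e4 : (m : ℝ) < a + M := by linarith
      have e5 : a < m + 1 := by exact_mod_cast e3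
      have e6 : m < a + M := by exact_mod_cast e4
      have hi : (m - a).toNat < M := by omega
      refine ⟨(m - a).toNat, by simpa using hi, ?_⟩
      obtain ⟨b1, b2, b3⟩ := hy _ hi
      have : H (y (m - a).toNat) = H x := by
        have e7 : (((m - a).toNat : ℤ) : ℝ) = ((m - a : ℤ) : ℝ) := by
          rw [Int.toNat_of_nonneg (by omega)]
        push_cast at e7
        rw [b3, hm', e7]
        ring
      simp only [hm.injective this]
    · rintro ⟨i, hi, rfl⟩
      have hi : i < M := by simpa using hi
      refine (hA _).2 ⟨a + i, ?_⟩
      rw [(hy i hi).2.2]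
      push_cast
      ring
  refine ⟨y, hy, ?_, ?_⟩
  · rw [himg]
    exact (Finset.finite_toSet _).image _
  · intro φ
    rw [himg, finsum_mem_image, finsum_mem_coe_finset]
    intro i hi k hk hik
    have hi : i < M := by simpa using hi
    have hk : k < M := by simpa using hk
    obtain ⟨b1, b2, b3⟩ := hy i hi
    obtain ⟨c1, c2, c3⟩ := hy k hk
    have := aux_inj z _ _ b1 b2 c1 c2 hik
    rw [this] at b3
    have : (i : ℝ) = k := by linarith
    exact_mod_cast this

lemma aux_transfer_s8 (f : AddCircle (1:ℝ) → AddCircle (1:ℝ))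
    (hfin : ∀ n x, ((f^[n]) ⁻¹' {x}).Finite) (n : ℕ) : ∀ (φ : AddCircle (1:ℝ) → ℝ) (z : AddCircle (1:ℝ)),
    (transfer f)^[n] φ z = ∑ᶠ y ∈ (f^[n]) ⁻¹' {z}, φ y := by
  induction n with
  | zero =>
    intro φ z
    simp only [Function.iterate_zero, id_eq, Set.preimage_id]
    rw [finsum_mem_singleton]
  | succ n ih =>
    intro φ z
    rw [Function.iterate_succ_apply, ih]
    have : (f^[n+1]) ⁻¹' {z} = ⋃ y ∈ (f^[n]) ⁻¹' {z}, f ⁻¹' {y} := by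
      ext w
      simp [Function.iterate_succ_apply]
    rw [this, finsum_mem_biUnion]
    · rfl
    · intro a _ b _ hab
      refine Set.disjoint_left.2 ?_
      intro w hw hw'
      simp at hw hw'
      exact hab (hw.symm.trans hw')
    · exact hfin n z
    · intro y _
      simpa using hfin 1 y

lemma aux_periodic_bdd (u : ℝ → ℝ) (hc : Continuous u) (hp : ∀ x, u (x + 1) = u x) :
    BddAbove (Set.range fun x => |u x|) := by
  have hper : Function.Periodic (fun x => |u x|) 1 := fun x => by simp [hp]
  have h := hper.image_Icc one_pos 0
  rw [← h]
  exact (isCompact_Icc.image hc.abs).bddAbove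

lemma aux_main_s8
    (f : AddCircle (1:ℝ) → AddCircle (1:ℝ)) (F : ℝ → ℝ) (K : ℕ) (hK : 2 ≤ K)
    (hFc : Continuous F) (hdeg : ∀ x : ℝ, F (x + 1) = F x + K) (lam : ℝ) (hlam : 1 < lam)
    (hexp : ∀ x y, x ≤ y → lam * (y - x) ≤ F y - F x)
    (hfF : ∀ x : ℝ, f (x : AddCircle (1:ℝ)) = ((F x : ℝ) : AddCircle (1:ℝ)))
    (u : AddCircle (1:ℝ) → ℝ) (C0 C1 : ℝ) (hC1 : 0 ≤ C1) (h0 : ∀ x, |u x| ≤ C0)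
    (h1 : ∀ x y : ℝ, x ≤ y → |u y - u x| ≤ C1 * (y - x))
    (z : AddCircle (1:ℝ)) (n j : ℕ) (hn : 1 ≤ n) :
    |(transfer f)^[n] (fun x => u x * u (f^[j] x)) z - ∑ᶠ p ∈ FixPts f n, u p * u (f^[j] p)| ≤
      C0 ^ 2 + C0 * C1 * (1 + (K : ℝ) ^ j) := by
  have hC0 : 0 ≤ C0 := (abs_nonneg _).trans (h0 z)
  have itexp : ∀ n : ℕ, ∀ x y, x ≤ y → lam ^ n * (y - x) ≤ F^[n] y - F^[n] x := by
    intro n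
    induction n with
    | zero => intro x y _; simp
    | succ n ih =>
      intro x y hxy
      rw [Function.iterate_succ_apply, Function.iterate_succ_apply]
      have e1 := hexp x y hxy
      have e0 : 0 ≤ lam * (y - x) := mul_nonneg (by linarith) (by linarith)
      have e2 := ih (F x) (F y) (by linarith)
      have e3 : lam ^ n * (lam * (y - x)) ≤ lam ^ n * (F y - F x) :=
        mul_le_mul_of_nonneg_left e1 (by positivity)
      rw [pow_succ, mul_assoc]
      linarith
  have hdegm : ∀ m : ℕ, ∀ x, F (x + m) = F x + K * m := by
    intro m
    induction m with
    | zero => intro x; simp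
    | succ m ih =>
      intro x
      push_cast
      rw [← add_assoc, hdeg, ih]
      ring
  have itdeg : ∀ n : ℕ, ∀ x, F^[n] (x + 1) = F^[n] x + (K ^ n : ℕ) := by
    intro n
    induction n with
    | zero => intro x; simp
    | succ n ih =>
      intro x
      rw [Function.iterate_succ_apply', Function.iterate_succ_apply', ih, hdegm]
      push_cast
      ring
  have itf : ∀ n : ℕ, ∀ x : ℝ, f^[n] (x : AddCircle (1:ℝ)) = ((F^[n] x : ℝ) : AddCircle (1:ℝ)) := by
    intro n
    induction n with
    | zero => intro x; simp
    | succ n ih =>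
      intro x
      rw [Function.iterate_succ_apply', Function.iterate_succ_apply', ih, hfF]
  have itc : ∀ n : ℕ, Continuous (F^[n]) := fun n => hFc.iterate n
  have itmono : ∀ n : ℕ, StrictMono (F^[n]) := by
    intro n x y hxy
    have e := itexp n x y hxy.le
    have : 0 < lam ^ n * (y - x) := mul_pos (by positivity) (by linarith)
    linarith
  have ceil1 : ∀ x : ℝ, x ≤ (⌈x⌉ : ℝ) ∧ (⌈x⌉ : ℝ) < x + 1 := fun x => ⟨Int.le_ceil x, Int.ceil_lt_add_one x⟩
  have hpre : ∀ n : ℕ, ∀ z x : ℝ, (x : AddCircle (1:ℝ)) ∈ (f^[n]) ⁻¹' {(z : AddCircle (1:ℝ))} ↔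
      ∃ m : ℤ, F^[n] x = z + m := by
    intro n z x
    rw [Set.mem_preimage, itf, Set.mem_singleton_iff, aux_coe_eq]
  have hfin : ∀ n x, ((f^[n]) ⁻¹' {x}).Finite := by
    intro n x
    obtain ⟨z, rfl⟩ := QuotientAddGroup.mk_surjective x
    obtain ⟨y, -, h, -⟩ := aux_param ((f^[n]) ⁻¹' {(z : AddCircle (1:ℝ))}) (F^[n]) (itmono n) (itc n) (K ^ n)
      (itdeg n) z z ⌈F^[n] z - z⌉ (ceil1 _).1 (ceil1 _).2 (hpre n z)
    exact h
  rw [aux_transfer_s8 f hfin]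
  obtain ⟨z, rfl⟩ := QuotientAddGroup.mk_surjective z
  obtain ⟨M, hM⟩ : ∃ M, K ^ n = M + 1 := ⟨K ^ n - 1, by
    have : 0 < K ^ n := by positivity
    omega⟩
  obtain ⟨y, hy, -, hysum⟩ := aux_param ((f^[n]) ⁻¹' {(z : AddCircle (1:ℝ))}) (F^[n]) (itmono n) (itc n) (K ^ n)
      (itdeg n) z z ⌈F^[n] z - z⌉ (ceil1 _).1 (ceil1 _).2 (hpre n z)
  obtain ⟨q, hq, -, hqsum⟩ := aux_param (FixPts f n) (fun x => F^[n] x - x)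
      (by
        intro x y hxy
        have e := itexp n x y hxy.le
        have e2 : 1 < lam ^ n := one_lt_pow₀ hlam (by omega)
        have : 1 * (y - x) < lam ^ n * (y - x) := mul_lt_mul_of_pos_right e2 (by linarith)
        show F^[n] x - x < F^[n] y - y
        linarith) ((itc n).sub continuous_id) M
      (by
        intro x
        show F^[n] (x + 1) - (x + 1) = F^[n] x - x + M
        rw [itdeg, hM]
        push_cast
        ring) z 0 ⌈F^[n] z - z⌉ (by simpa using (ceil1 (F^[n] z - z)).1)
        (by simpa using (ceil1 (F^[n] z - z)).2)
      (by
        intro x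
        show f^[n] (x : AddCircle (1:ℝ)) = x ↔ _
        rw [itf, aux_coe_eq]
        refine exists_congr fun m => ?_
        constructor <;> intro h <;> linarith)
  change |∑ᶠ y ∈ (f^[n]) ⁻¹' {(z : AddCircle (1:ℝ))}, u y * u (f^[j] y) - _| ≤ _
  rw [hysum (fun x => u x * u (f^[j] x)), hqsum (fun x => u x * u (f^[j] x)), hM, Finset.sum_range_succ]
  rw [hM] at hy
  set V : ℝ → ℝ := fun x => C0 * C1 * (x + F^[j] x) with hV
  set g : ℝ → ℝ := fun x => u x * u (f^[j] (x : AddCircle (1:ℝ))) with hg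
  have hVm : Monotone V := by
    intro x y hxy
    have := (itmono j).monotone hxy
    exact mul_le_mul_of_nonneg_left (by linarith) (mul_nonneg hC0 hC1)
  have hgV : ∀ x y : ℝ, x ≤ y → |g x - g y| ≤ V y - V x := by
    intro x y hxy
    have e1 := h1 x y hxy
    have e2 := h1 (F^[j] x) (F^[j] y) ((itmono j).monotone hxy)
    have : g x - g y = -((u y - u x) * u (F^[j] y : ℝ) + u x * (u (F^[j] y : ℝ) - u (F^[j] x : ℝ))) := by
      simp only [hg, itf]
      ring
    rw [this, abs_neg]
    refine (abs_add_le _ _).trans ?_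
    rw [abs_mul, abs_mul]
    have e3 : |u y - u x| * |u (F^[j] y : ℝ)| ≤ (C1 * (y - x)) * C0 :=
      mul_le_mul e1 (h0 _) (abs_nonneg _) ((abs_nonneg _).trans e1)
    have e4 : |u x| * |u (F^[j] y : ℝ) - u (F^[j] x : ℝ)| ≤ C0 * (C1 * (F^[j] y - F^[j] x)) :=
      mul_le_mul (h0 _) e2 (abs_nonneg _) hC0
    simp only [hV]
    linarith
  have hterm : ∀ i ∈ Finset.range M, |g (y i) - g (q i)| ≤ V (y (i + 1)) - V (y i) := by
    intro i hi
    have hi : i < M := by simpa using hi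
    obtain ⟨a1, a2, a3⟩ := hy i (by omega)
    obtain ⟨b1, b2, b3⟩ := hy (i + 1) (by omega)
    obtain ⟨c1, c2, c3⟩ := hq i hi
    have o1 : y i ≤ q i := (itmono n).le_iff_le.1 (by linarith)
    have o2 : q i ≤ y (i + 1) := (itmono n).le_iff_le.1 (by push_cast at b3; linarith)
    exact (hgV _ _ o1).trans (by linarith [hVm o2])
  have hsum : |∑ i ∈ Finset.range M, g (y i) - ∑ i ∈ Finset.range M, g (q i)| ≤ C0 * C1 * (1 + (K : ℝ) ^ j) := by
    rw [← Finset.sum_sub_distrib]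
    refine (Finset.abs_sum_le_sum_abs _ _).trans ((Finset.sum_le_sum hterm).trans ?_)
    rw [Finset.sum_range_sub (fun i => V (y i))]
    have e1 := hVm (hy M (by omega)).2.1.le
    have e2 := hVm (hy 0 (by omega)).1
    have e3 : V (z + 1) - V z = C0 * C1 * (1 + (K : ℝ) ^ j) := by
      simp only [hV, itdeg]
      push_cast
      ring
    linarith
  have hlast : |g (y M)| ≤ C0 ^ 2 := by
    rw [hg, abs_mul, sq]
    exact mul_le_mul (h0 _) (h0 _) (abs_nonneg _) hC0
  calc _ = |g (y M) + (∑ i ∈ Finset.range M, g (y i) - ∑ i ∈ Finset.range M, g (q i))| := by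
        congr 1
        simp only [hg]
        ring
    _ ≤ _ := (abs_add_le _ _).trans (add_le_add hlast hsum)

/-- Comparison of `ℒⁿ(ĥ·(ĥ∘f^j))(z)` with the corresponding sum over `Fix(fⁿ)`. -/
theorem stmt8
    (K : ℕ) (hK : 2 ≤ K)
    (F : ℝ → ℝ) (hF : ContDiff ℝ 2 F)
    (hdeg : ∀ x : ℝ, F (x + 1) = F x + K)
    (lam : ℝ) (hlam : 1 < lam)
    (hexp : ∀ x : ℝ, lam ≤ deriv F x)
    (f : AddCircle (1:ℝ) → AddCircle (1:ℝ))
    (hfF : ∀ x : ℝ, f (x : AddCircle (1:ℝ)) = ((F x : ℝ) : AddCircle (1:ℝ)))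
    (f' : AddCircle (1:ℝ) → ℝ)
    (hf'F : ∀ x : ℝ, f' (x : AddCircle (1:ℝ)) = deriv F x)
    (μ : Measure (AddCircle (1:ℝ))) [IsProbabilityMeasure μ]
    (hinv : ∀ φ : AddCircle (1:ℝ) → ℝ, Continuous φ → ∫ x, φ (f x) ∂μ = ∫ x, φ x ∂μ)
    (hμ : ∀ φ : AddCircle (1:ℝ) → ℝ, Continuous φ → ∫ x, transfer f φ x ∂μ = (K : ℝ) * ∫ x, φ x ∂μ)
    :
    ∀ z : AddCircle (1:ℝ), ∀ n j : ℕ, 1 ≤ n → 1 ≤ j → j ≤ n - 1 →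
      |(transfer f)^[n]
          (fun x => (Real.log (f' x) - ∫ y, Real.log (f' y) ∂μ) *
            (Real.log (f' (f^[j] x)) - ∫ y, Real.log (f' y) ∂μ)) z -
        ∑ᶠ p ∈ FixPts f n, (Real.log (f' p) - ∫ y, Real.log (f' y) ∂μ) *
          (Real.log (f' (f^[j] p)) - ∫ y, Real.log (f' y) ∂μ)| ≤
      (⨆ x : ℝ, |Real.log (deriv F x) - ∫ y, Real.log (f' y) ∂μ|) ^ 2 +
        (⨆ x : ℝ, |Real.log (deriv F x) - ∫ y, Real.log (f' y) ∂μ|) *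
          (⨆ x : ℝ, |deriv (fun t => Real.log (deriv F t)) x|) * (1 + (K : ℝ) ^ j) := by
  intro z n j hn _ _
  set c := ∫ y, Real.log (f' y) ∂μ
  have hpos : ∀ x, 0 < deriv F x := fun x => by linarith [hexp x]
  have hF1 : ContDiff ℝ 1 (deriv F) := by
    have : ContDiff ℝ (1 + 1) F := by norm_num; exact hF
    exact ((contDiff_succ_iff_deriv).1 this).2.2
  have hd : Differentiable ℝ F := hF.differentiable (by norm_num)
  have hL : ContDiff ℝ 1 (fun t => Real.log (deriv F t)) := hF1.log (fun x => (hpos x).ne')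
  have hLd : Differentiable ℝ (fun t => Real.log (deriv F t)) := hL.differentiable (by norm_num)
  have hper : ∀ x, deriv F (x + 1) = deriv F x := by
    intro x
    rw [← deriv_comp_add_const]
    simp only [hdeg]
    rw [deriv_add_const]
  have hper2 : ∀ x, deriv (fun t => Real.log (deriv F t)) (x + 1) = deriv (fun t => Real.log (deriv F t)) x := by
    intro x
    rw [← deriv_comp_add_const]
    simp only [hper]
  have b0 := aux_periodic_bdd (fun x => Real.log (deriv F x) - c) (hL.continuous.sub continuous_const)
    (fun x => by simp only [hper])
  have b1 := aux_periodic_bdd _ (hL.continuous_deriv (by norm_num)) hper2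
  refine aux_main_s8 f F K hK hd.continuous hdeg lam hlam ?_ hfF (fun x => Real.log (f' x) - c) _ _ ?_ ?_ ?_ z n j hn
  · intro x y hxy
    exact mul_sub_le_image_sub_of_le_deriv hd hexp hxy
  · exact (abs_nonneg _).trans (le_ciSup b1 0)
  · intro x
    obtain ⟨x, rfl⟩ := QuotientAddGroup.mk_surjective x
    have := le_ciSup b0 x
    have e := hf'F x
    change |Real.log (f' (x : AddCircle (1:ℝ))) - c| ≤ _
    rw [e]
    exact this
  · intro x y hxy
    have := Convex.norm_image_sub_le_of_norm_deriv_le (f := fun t => Real.log (deriv F t)) (s := Set.univ)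
      (x := x) (y := y) (fun t _ => hLd t) (fun t _ => le_ciSup b1 t) convex_univ trivial trivial
    simp only [Real.norm_eq_abs, abs_of_nonneg (sub_nonneg.2 hxy)] at this
    simpa only [hf'F, sub_sub_sub_cancel_right] using this
end
end
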